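/- Let T: 𝕋^d → 𝕋^d be T(x) = Ax + b where A is a unipotent integer matrix and b ∈ 𝕋^d, and suppose T is ergodic with respect to Haar measure. Then there exist an ergodic affine map S: 𝕋^d → 𝕋^d with unipotent linear part in Jordan block form and a surjective continuous group homomorphism-plus-translation P: 𝕋^d → 𝕋^d such that P∘T = S∘P; i.e., T is a factor of S. -/

import Mathlib

open Filter MeasureTheory Topology

/-- The affine map `x ↦ Ax + b` of the torus `𝕋^d` induced by an integer matrix `A`
and a translation `b`. -/
noncomputable def torusAffine {d : ℕ} (A : Matrix (Fin d) (Fin d) ℤ)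
    (b : Fin d → AddCircle (1 : ℝ)) :
    (Fin d → AddCircle (1 : ℝ)) → (Fin d → AddCircle (1 : ℝ)) :=
  fun x i => (∑ j, A i j • x j) + b i

theorem List.IsChain.cons_append {α : Type*} {R : α → α → Prop} {a : α} {l₁ l₂ : List α}
    (h₁ : (a :: l₁).IsChain R) (h₂ : l₂.IsChain R) (h : ∀ b, ∀ c ∈ l₂.head?, R b c) :
    (a :: (l₁ ++ l₂)).IsChain R := by
  rw [← List.cons_append, List.isChain_append]
  exact ⟨h₁, h₂, fun x _ y hy => h x y hy⟩

section JordanBasis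

variable {K V : Type*} [Field K] [AddCommGroup V] [Module K V]

/-- In the span of `v, f v, …, f ^ k v`, one can prescribe the values of
`φ, φ ∘ f, …, φ ∘ f ^ k` if `φ (f ^ k v) = 1` and `f ^ (k + 1) = 0`. -/
theorem exists_mem_span_iterates_dual_eq {f : Module.End K V} {φ : Module.Dual K V} {v : V}
    {k : ℕ} (hf : f ^ (k + 1) = 0) (hv : φ ((f ^ k) v) = 1) (c : ℕ → K) :
    ∃ w ∈ Submodule.span K ((fun i => (f ^ i) v) '' Set.Iio (k + 1)),
      ∀ i < k + 1, φ ((f ^ i) w) = c i := by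
  suffices H : ∀ j ≤ k + 1, ∃ w ∈ Submodule.span K ((fun i => (f ^ i) v) '' Set.Iio (k + 1)),
      ∀ i < k + 1, k + 1 ≤ i + j → φ ((f ^ i) w) = c i by
    obtain ⟨w, hw, h⟩ := H (k + 1) le_rfl
    exact ⟨w, hw, fun i hi => h i hi (by omega)⟩
  intro j
  induction j with
  | zero => exact fun _ => ⟨0, zero_mem _, fun i _ _ => by omega⟩
  | succ j ih =>
    intro hj
    obtain ⟨w, hw, h⟩ := ih (by omega)
    refine ⟨w + (c (k - j) - φ ((f ^ (k - j)) w)) • (f ^ j) v,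
      add_mem hw (Submodule.smul_mem _ _ (Submodule.subset_span ⟨j, by simp; omega, rfl⟩)),
      fun i hi hij => ?_⟩
    rw [map_add, map_smul, map_add, map_smul, ← Module.End.mul_apply (f ^ i), ← pow_add]
    rcases eq_or_lt_of_le (show k - j ≤ i by omega) with rfl | hlt
    · rw [show k - j + j = k by omega, hv]
      simp
    · rw [pow_eq_zero_of_le (show k + 1 ≤ i + j by omega) hf]
      simpa using h i hi (by omega)

/-- **Jordan basis of a nilpotent endomorphism**, as a list of vectors each of which is mapped
either to `0` or to its predecessor. -/
theorem Module.End.exists_jordan_list_of_isNilpotent [FiniteDimensional K V]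
    (f : Module.End K V) (hf : IsNilpotent f) :
    ∃ l : List V, l.length = Module.finrank K V ∧ Submodule.span K {x | x ∈ l} = ⊤ ∧
      (0 :: l).IsChain (fun a b => f b = 0 ∨ f b = a) := by
  induction hn : Module.finrank K V using Nat.strong_induction_on generalizing V with
  | _ n ih =>
  subst hn
  rcases subsingleton_or_nontrivial V with hV | hV
  · exact ⟨[], by simp [Module.finrank_zero_of_subsingleton], Subsingleton.elim _ _, by simp⟩
  obtain ⟨k, hk, hmin⟩ : ∃ k, f ^ (k + 1) = 0 ∧ f ^ k ≠ 0 := by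
    classical
    have h0 : Nat.find hf ≠ 0 := fun h => by simpa [h] using Nat.find_spec hf
    obtain ⟨k, hk⟩ := Nat.exists_eq_succ_of_ne_zero h0
    exact ⟨k, by simpa only [hk] using Nat.find_spec hf, Nat.find_min hf (by omega)⟩
  obtain ⟨v, hv⟩ : ∃ v, (f ^ k) v ≠ 0 := by
    by_contra! h
    exact hmin (LinearMap.ext h)
  obtain ⟨φ, hφ⟩ := Module.Projective.exists_dual_eq_one K hv
  let g : V →ₗ[K] (Fin (k + 1) → K) := LinearMap.pi fun i => φ ∘ₗ (f ^ (i : ℕ))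
  have hg : ∀ x (i : Fin (k + 1)), g x i = φ ((f ^ (i : ℕ)) x) := fun _ _ => rfl
  have hU : ∀ x ∈ LinearMap.ker g, f x ∈ LinearMap.ker g := by
    intro x hx
    ext i
    rw [hg, ← Module.End.mul_apply, ← pow_succ]
    rcases Nat.lt_or_ge (i + 1 : ℕ) (k + 1) with hi | hi
    · exact congrFun hx ⟨i + 1, hi⟩
    · rw [pow_eq_zero_of_le hi hk]
      simp
  have hsurj : LinearMap.range g = ⊤ := by
    refine LinearMap.range_eq_top.2 fun c => ?_
    obtain ⟨w, -, hw⟩ := exists_mem_span_iterates_dual_eq hk hφ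
      (fun i => if h : i < k + 1 then c ⟨i, h⟩ else 0)
    exact ⟨w, funext fun i => by rw [hg, hw i i.2, dif_pos i.2]⟩
  have hdim := LinearMap.finrank_range_add_finrank_ker g
  rw [hsurj, finrank_top, Module.finrank_fin_fun] at hdim
  obtain ⟨l, hl, hspan, hchain⟩ := ih _ (by omega) (f.restrict hU)
    (hf.imp fun m hm => by
      ext x
      rw [Module.End.pow_restrict]
      simp [LinearMap.restrict_apply, hm]) rfl
  refine ⟨(List.range (k + 1)).map (fun i => (f ^ (k - i)) v) ++ l.map (LinearMap.ker g).subtype,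
    by simp [hl, hdim], ?_, ?_⟩
  · rw [eq_top_iff]
    intro u _
    obtain ⟨w, hw, h⟩ := exists_mem_span_iterates_dual_eq hk hφ (fun i => φ ((f ^ i) u))
    have hker : u - w ∈ LinearMap.ker g := by
      ext i
      simp [hg, h i i.2]
    rw [← add_sub_cancel w u]
    refine add_mem (Submodule.span_mono ?_ hw) ?_
    · rintro _ ⟨i, hi, rfl⟩
      have hi : i < k + 1 := hi
      simp only [List.mem_append, List.mem_map, List.mem_range, Set.mem_ofPred_eq]
      exact Or.inl ⟨k - i, by omega, by rw [show k - (k - i) = i by omega]⟩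
    · have : (⟨u - w, hker⟩ : LinearMap.ker g) ∈ Submodule.span K {x | x ∈ l} := by simp [hspan]
      have := Submodule.mem_map_of_mem (f := (LinearMap.ker g).subtype) this
      rw [Submodule.map_span] at this
      refine Submodule.span_mono ?_ this
      rintro _ ⟨x, hx, rfl⟩
      exact List.mem_append_right _ (List.mem_map_of_mem hx)
  · have hmap : (0 :: l.map (LinearMap.ker g).subtype).IsChain (fun a b => f b = 0 ∨ f b = a) := by
      rw [← map_zero (LinearMap.ker g).subtype, List.isChain_cons_map]
      refine hchain.imp fun a b hab => ?_
      simpa [Subtype.ext_iff] using hab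
    refine List.IsChain.cons_append ?_ hmap.tail fun b c hc => ?_
    · rw [List.isChain_iff_getElem]
      rintro (_ | i) hi
      · left
        simp [← Module.End.mul_apply, ← pow_succ', hk]
      · right
        simp at hi
        simp [← Module.End.mul_apply, ← pow_succ']
        congr 2
        omega
    · rcases hl' : l.map (LinearMap.ker g).subtype with _ | ⟨x, l'⟩
      · simp only [hl', List.head?_nil, Option.mem_def, reduceCtorEq] at hc
      · rw [hl'] at hc hmap
        obtain rfl : x = c := by simpa using hc
        exact Or.inl (by simpa using (List.isChain_cons_cons.1 hmap).1)

end JordanBasis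

section Matrix

open scoped Matrix

/-- An integer matrix which is nilpotent is conjugated, by an integer matrix with nonzero
determinant, to a matrix with zeros and ones below the diagonal and zeros elsewhere. -/
theorem Matrix.exists_jordan_semiconj_of_isNilpotent {d : ℕ} {N : Matrix (Fin d) (Fin d) ℤ}
    (hN : IsNilpotent N) :
    ∃ J P : Matrix (Fin d) (Fin d) ℤ, P.det ≠ 0 ∧ P * N = J * P ∧
      (∀ i j : Fin d, (i : ℕ) = (j : ℕ) + 1 → (J i j = 0 ∨ J i j = 1)) ∧
      ∀ i j : Fin d, (i : ℕ) ≠ (j : ℕ) + 1 → J i j = 0 := by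
  classical
  let M : Matrix (Fin d) (Fin d) ℚ := N.map (Int.castRingHom ℚ)
  have hM : IsNilpotent (Matrix.toLin' Mᵀ) := by
    obtain ⟨n, hn⟩ := hN
    refine ⟨n, ?_⟩
    have hMn : M ^ n = 0 := by
      change (Int.castRingHom ℚ).mapMatrix N ^ n = 0
      rw [← map_pow, hn, map_zero]
    rw [← Matrix.toLin'_pow, ← Matrix.transpose_pow, hMn]
    simp
  obtain ⟨l, hl, hspan, hchain⟩ := Module.End.exists_jordan_list_of_isNilpotent _ hM
  rw [Module.finrank_fin_fun] at hl
  let Q : Matrix (Fin d) (Fin d) ℚ := fun i => l.get (i.cast hl.symm)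
  have hQ : Q.det ≠ 0 := by
    have hli : LinearIndependent ℚ Q.row := by
      refine linearIndependent_of_top_le_span_of_card_eq_finrank ?_ (by simp)
      rw [← hspan]
      refine Submodule.span_mono fun x hx => ?_
      obtain ⟨i, rfl⟩ := List.get_of_mem hx
      exact ⟨i.cast hl, rfl⟩
    exact ((Matrix.isUnit_iff_isUnit_det Q).1
      (Matrix.linearIndependent_rows_iff_isUnit.1 hli)).ne_zero
  obtain ⟨b, hb⟩ := IsLocalization.exist_integer_multiples_of_finite (nonZeroDivisors ℤ)
    (fun p : Fin d × Fin d => Q p.1 p.2)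
  choose p hp using hb
  have hb0 : ((b : ℤ) : ℚ) ≠ 0 := by exact_mod_cast nonZeroDivisors.coe_ne_zero b
  let P : Matrix (Fin d) (Fin d) ℤ := fun i j => p (i, j)
  have hP : P.map (Int.castRingHom ℚ) = ((b : ℤ) : ℚ) • Q := by
    ext i j
    simpa using hp (i, j)
  let J : Matrix (Fin d) (Fin d) ℤ := fun i j =>
    if (i : ℕ) = j + 1 ∧ Q i ᵥ* M ≠ 0 then 1 else 0
  have hrow : ∀ i, Q i ᵥ* M = (fun j => (J i j : ℚ)) ᵥ* Q := by
    intro i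
    rw [List.isChain_iff_getElem] at hchain
    have hi := hchain i (by simp [hl])
    simp only [List.getElem_cons_succ, Matrix.toLin'_apply, Matrix.mulVec_transpose] at hi
    change Q i ᵥ* M = 0 ∨ Q i ᵥ* M = _ at hi
    by_cases h0 : Q i ᵥ* M = 0
    · have : (fun j => (J i j : ℚ)) = 0 := by
        ext j
        simp [J, h0]
      rw [h0, this, Matrix.zero_vecMul]
    · replace hi := hi.resolve_left h0
      obtain ⟨_ | i, hil⟩ := i
      · exact absurd hi h0
      · have : (fun j => (J ⟨i + 1, hil⟩ j : ℚ)) = Pi.single ⟨i, by omega⟩ 1 := by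
          ext j
          simp [J, h0, Pi.single_apply, Fin.ext_iff, eq_comm]
        rw [this, Matrix.single_one_vecMul]
        exact hi
  have hQM : Q * M = J.map (Int.castRingHom ℚ) * Q := by
    ext i j
    exact congrFun (hrow i) j
  refine ⟨J, P, fun h => ?_, ?_, fun i j _ => ?_, fun i j hij => ?_⟩
  · have := congrArg (Int.castRingHom ℚ) h
    rw [RingHom.map_det, RingHom.mapMatrix_apply, hP, Matrix.det_smul, map_zero] at this
    exact mul_ne_zero (pow_ne_zero _ hb0) hQ this
  · apply Matrix.map_injective (Int.castRingHom ℚ).injective_int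
    simp only [Matrix.map_mul, hP]
    rw [Matrix.smul_mul, Matrix.mul_smul]
    exact congrArg _ hQM
  · simp only [J]
    split_ifs <;> simp
  · simp [J, hij]

end Matrix

section Torus

variable {d : ℕ}

theorem torusAffine_torusAffine (A B : Matrix (Fin d) (Fin d) ℤ)
    (a b x : Fin d → AddCircle (1 : ℝ)) :
    torusAffine A a (torusAffine B b x) = torusAffine (A * B) (torusAffine A a b) x := by
  ext i
  simp only [torusAffine, Matrix.mul_apply, smul_add, Finset.sum_add_distrib, Finset.smul_sum,
    Finset.sum_smul, mul_smul]
  rw [Finset.sum_comm, add_assoc]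

theorem torusAffine_zero (A : Matrix (Fin d) (Fin d) ℤ) (b : Fin d → AddCircle (1 : ℝ)) :
    torusAffine A b 0 = b := by
  ext i
  simp [torusAffine]

theorem continuous_torusAffine (A : Matrix (Fin d) (Fin d) ℤ) (b : Fin d → AddCircle (1 : ℝ)) :
    Continuous (torusAffine A b) := by
  unfold torusAffine
  fun_prop

theorem surjective_torusAffine_of_det_ne_zero {P : Matrix (Fin d) (Fin d) ℤ} (hP : P.det ≠ 0) :
    Function.Surjective (torusAffine P 0) := by
  intro y
  refine ⟨torusAffine P.adjugate 0 fun i => DivisibleBy.div (y i) P.det, ?_⟩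
  rw [torusAffine_torusAffine, Matrix.mul_adjugate]
  ext i
  simp [torusAffine, Matrix.one_apply, DivisibleBy.div_cancel _ hP]

theorem measurePreserving_torusAffine_of_det_ne_zero {P : Matrix (Fin d) (Fin d) ℤ}
    (hP : P.det ≠ 0) : MeasurePreserving (torusAffine P 0) := by
  let f : (Fin d → AddCircle (1 : ℝ)) →+ (Fin d → AddCircle (1 : ℝ)) :=
    AddMonoidHom.mk' (torusAffine P 0) fun x y => by
      ext i
      simp [torusAffine, Finset.sum_add_distrib]
  exact AddMonoidHom.measurePreserving (f := f) (continuous_torusAffine P 0)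
    (surjective_torusAffine_of_det_ne_zero hP) rfl

end Torus

/-- If `T(x) = Ax + b` on `𝕋^d` with `A` unipotent integer and `T` ergodic for Haar
measure, then there are an ergodic affine `S(x) = Jx + c` with `J` unipotent in Jordan
block form (ones on the diagonal, zeros and ones on the subdiagonal, zeros elsewhere)
and a surjective affine map `P` (an integer matrix plus a translation) with
`P ∘ T = S ∘ P`, i.e. `T` is a factor of `S`. -/
theorem stmt_9 {d : ℕ} (A : Matrix (Fin d) (Fin d) ℤ) (b : Fin d → AddCircle (1 : ℝ))
    (hA : ∃ n : ℕ, (A - 1) ^ n = 0)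
    (hT : Ergodic (torusAffine A b)) :
    ∃ (J : Matrix (Fin d) (Fin d) ℤ) (c : Fin d → AddCircle (1 : ℝ))
      (Pm : Matrix (Fin d) (Fin d) ℤ) (t : Fin d → AddCircle (1 : ℝ)),
      (∀ i, J i i = 1) ∧
      (∀ i j : Fin d, (i : ℕ) = (j : ℕ) + 1 → (J i j = 0 ∨ J i j = 1)) ∧
      (∀ i j : Fin d, i ≠ j → (i : ℕ) ≠ (j : ℕ) + 1 → J i j = 0) ∧
      (∃ n : ℕ, (J - 1) ^ n = 0) ∧
      Ergodic (torusAffine J c) ∧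
      Function.Surjective (torusAffine Pm t) ∧
      (torusAffine Pm t) ∘ (torusAffine A b) = (torusAffine J c) ∘ (torusAffine Pm t) := by
  obtain ⟨J, P, hP, hPJ, hsub, hzero⟩ := Matrix.exists_jordan_semiconj_of_isNilpotent hA
  have hcomm : P * A = (J + 1) * P := by
    rw [add_mul, one_mul, ← hPJ, mul_sub, mul_one, sub_add_cancel]
  have hsemi : torusAffine P 0 ∘ torusAffine A b =
      torusAffine (J + 1) (torusAffine P 0 b) ∘ torusAffine P 0 := by
    funext x
    rw [Function.comp_apply, Function.comp_apply, torusAffine_torusAffine,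
      torusAffine_torusAffine, torusAffine_zero, hcomm]
  refine ⟨J + 1, torusAffine P 0 b, P, 0, fun i => ?_, fun i j hij => ?_, fun i j hne hij => ?_,
    ?_, ?_, surjective_torusAffine_of_det_ne_zero hP, hsemi⟩
  · simp [hzero i i (by omega)]
  · have hne : i ≠ j := by
      rintro rfl
      omega
    simpa [Matrix.one_apply_ne hne] using hsub i j hij
  · simp [Matrix.one_apply_ne hne, hzero i j hij]
  · obtain ⟨n, hn⟩ := hA
    refine ⟨n, ?_⟩
    have h : J ^ n * P = 0 := by
      have hconj : SemiconjBy P (A - 1) J := hPJ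
      rw [← (hconj.pow_right n).eq, hn, mul_zero]
    have hdet : P.det • J ^ n = 0 := by
      rw [← mul_one (J ^ n), ← Matrix.mul_smul, ← Matrix.mul_adjugate, ← Matrix.mul_assoc, h,
        Matrix.zero_mul]
    rw [add_sub_cancel_right]
    exact (smul_eq_zero.1 hdet).resolve_left hP
  · exact (measurePreserving_torusAffine_of_det_ne_zero hP).ergodic_of_ergodic_semiconj hT
      (continuous_torusAffine _ _).measurable (congrFun hsemi)
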